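/- arXiv:2001.07541 — 5 statements merged into one kernel-verified Lean document; each statement's English description precedes it below -/
import Mathlib

section
/- Let O be an annotated ELH^r ontology, α an ELH^r axiom, and m a monomial, and let O' be obtained from O by exhaustively applying the normalization rules NF1–NF3. Then: (i) if O ⊨ (α,m), then O' ⊨ (α,m); and (ii) if O' ⊨ (α,m) and every concept name occurring in α occurs in O, then O ⊨ (α,m). -/
/- Common framework: provenance-annotated ELH^r.
   Monomials are modelled as finite sets of provenance variables
   (monomials modulo commutativity, associativity and ×-idempotency;
   the representative [m] of a monomial is then the monomial itself,
   the product is union, and 1 is the empty set). -/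

namespace Prov

abbrev Monomial (V : Type) := Finset V

/-- ELH^r concepts: C ::= A | ∃R.C | C ⊓ C | ⊤.  `∃R` is `ex R top`. -/
inductive Concept (C R : Type) : Type
  | top : Concept C R
  | atom : C → Concept C R
  | conj : Concept C R → Concept C R → Concept C R
  | ex : R → Concept C R → Concept C R

namespace Concept
variable {C R : Type}

/-- member of N_C ∪ {⊤} -/
def IsBasic : Concept C R → Prop
  | top => True
  | atom _ => True
  | conj _ _ => False
  | ex _ _ => False

def cnames : Concept C R → Set C
  | top => ∅
  | atom A => {A}
  | conj c d => c.cnames ∪ d.cnames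
  | ex _ c => c.cnames

def rnames : Concept C R → Set R
  | top => ∅
  | atom _ => ∅
  | conj c d => c.rnames ∪ d.rnames
  | ex r c => insert r c.rnames

def hasTop : Concept C R → Prop
  | top => True
  | atom _ => False
  | conj c d => c.hasTop ∨ d.hasTop
  | ex _ c => c.hasTop

/-- number of occurrences of concept and role names -/
def nameCount : Concept C R → ℕ
  | top => 0
  | atom _ => 1
  | conj c d => c.nameCount + d.nameCount
  | ex _ c => 1 + c.nameCount

end Concept

/-- Axioms: GCIs, role inclusions, range restrictions, and assertions.
    (Assertions `ca` are allowed with an arbitrary concept so that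
    instance queries C(a) and the auxiliary assertions ⊤(a) used by the
    completion algorithm are expressible; ELH^r assertions use a
    concept name.) -/
inductive Ax (C R Iv : Type) : Type
  | gci : Concept C R → Concept C R → Ax C R Iv
  | ri : R → R → Ax C R Iv
  | rr : R → C → Ax C R Iv
  | ca : Concept C R → Iv → Ax C R Iv
  | ra : R → Iv → Iv → Ax C R Iv

namespace Ax
variable {C R Iv : Type}

def IsELHr : Ax C R Iv → Prop
  | gci _ d => (∃ A, d = Concept.atom A) ∨ (∃ r, d = Concept.ex r Concept.top)
  | ca c _ => ∃ A, c = Concept.atom A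
  | _ => True

/-- normal form: GCIs of the form A ⊑ B, A ⊓ A' ⊑ B, A ⊑ ∃R, ∃R.A ⊑ B
    with A, A' ∈ N_C ∪ {⊤}, B ∈ N_C. -/
def IsNF : Ax C R Iv → Prop
  | gci c d =>
      ((∃ B, d = Concept.atom B) ∧
        (c.IsBasic ∨ (∃ a a', c = Concept.conj a a' ∧ a.IsBasic ∧ a'.IsBasic) ∨
          (∃ r a, c = Concept.ex r a ∧ a.IsBasic)))
      ∨ (c.IsBasic ∧ ∃ r, d = Concept.ex r Concept.top)
  | ca c _ => ∃ A, c = Concept.atom A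
  | _ => True

def IsAssertion : Ax C R Iv → Prop
  | ca _ _ => True
  | ra _ _ _ => True
  | _ => False

def cnames : Ax C R Iv → Set C
  | gci c d => c.cnames ∪ d.cnames
  | ri _ _ => ∅
  | rr _ A => {A}
  | ca c _ => c.cnames
  | ra _ _ _ => ∅

def rnames : Ax C R Iv → Set R
  | gci c d => c.rnames ∪ d.rnames
  | ri r s => {r, s}
  | rr r _ => {r}
  | ca c _ => c.rnames
  | ra r _ _ => {r}

def inds : Ax C R Iv → Set Iv
  | ca _ a => {a}
  | ra _ a b => {a, b}
  | _ => ∅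

def hasTop : Ax C R Iv → Prop
  | gci c d => c.hasTop ∨ d.hasTop
  | ca c _ => c.hasTop
  | _ => False

def nameCount : Ax C R Iv → ℕ
  | gci c d => c.nameCount + d.nameCount
  | ri _ _ => 2
  | rr _ _ => 2
  | ca c _ => c.nameCount + 1
  | ra _ _ _ => 3

end Ax

/-- annotated axiom -/
abbrev AnnAx (C R Iv V : Type) := Ax C R Iv × Monomial V

/-- a (not necessarily well-formed) set of annotated axioms -/
abbrev Ont (C R Iv V : Type) := Set (AnnAx C R Iv V)

namespace Ont
variable {C R Iv V : Type}
def cnames (O : Ont C R Iv V) : Set C := {A | ∃ p ∈ O, A ∈ p.1.cnames}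
def rnames (O : Ont C R Iv V) : Set R := {r | ∃ p ∈ O, r ∈ p.1.rnames}
def inds (O : Ont C R Iv V) : Set Iv := {a | ∃ p ∈ O, a ∈ p.1.inds}
def vars (O : Ont C R Iv V) : Set V := {v | ∃ p ∈ O, v ∈ p.2}
def hasTop (O : Ont C R Iv V) : Prop := ∃ p ∈ O, p.1.hasTop
end Ont

/-- annotated ELH^r ontology: a finite set of annotated ELH^r axioms whose
    annotations are provenance variables or 1 (i.e. monomials of ≤ 1 variable) -/
def IsOntology {C R Iv V : Type} (O : Ont C R Iv V) : Prop :=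
  O.Finite ∧ ∀ p ∈ O, p.1.IsELHr ∧ p.2.card ≤ 1

def IsNFOnt {C R Iv V : Type} (O : Ont C R Iv V) : Prop :=
  IsOntology O ∧ ∀ p ∈ O, p.1.IsNF

/-- Annotated interpretations.  `monI_inj` captures m^I = n^I iff [m] = [n]. -/
structure Interp (C R Iv V : Type) (Δ Δm : Type) where
  indI : Iv → Δ
  conI : C → Set (Δ × Δm)
  rolI : R → Set (Δ × Δ × Δm)
  monI : Monomial V → Δm
  monI_inj : Function.Injective monI
  neD : Nonempty Δ
  neDm : Nonempty Δm

namespace Interp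
variable {C R Iv V : Type} [DecidableEq V] {Δ Δm : Type}

/-- interpretation of complex concepts -/
def cInt (I : Interp C R Iv V Δ Δm) : Concept C R → Set (Δ × Δm)
  | Concept.top => {p | p.2 = I.monI ∅}
  | Concept.atom A => I.conI A
  | Concept.conj c d =>
      {p | ∃ x m n, (x, I.monI m) ∈ I.cInt c ∧ (x, I.monI n) ∈ I.cInt d ∧
            p = (x, I.monI (m ∪ n))}
  | Concept.ex r c =>
      {p | ∃ x e m n, (x, e, I.monI m) ∈ I.rolI r ∧ (e, I.monI n) ∈ I.cInt c ∧
            p = (x, I.monI (m ∪ n))}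

/-- interpretation of ran(R) -/
def ranI (I : Interp C R Iv V Δ Δm) (r : R) : Set (Δ × Δm) :=
  {p | ∃ d, (d, p.1, p.2) ∈ I.rolI r}

/-- satisfaction of an annotated axiom -/
def Sat (I : Interp C R Iv V Δ Δm) : Ax C R Iv → Monomial V → Prop
  | Ax.gci c d, m => ∀ x n, (x, I.monI n) ∈ I.cInt c → (x, I.monI (m ∪ n)) ∈ I.cInt d
  | Ax.ri r s, m => ∀ x y n, (x, y, I.monI n) ∈ I.rolI r → (x, y, I.monI (m ∪ n)) ∈ I.rolI s
  | Ax.rr r A, m => ∀ x n, (x, I.monI n) ∈ I.ranI r → (x, I.monI (m ∪ n)) ∈ I.conI A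
  | Ax.ca c a, m => (I.indI a, I.monI m) ∈ I.cInt c
  | Ax.ra r a b, m => (I.indI a, I.indI b, I.monI m) ∈ I.rolI r

def IsModel (I : Interp C R Iv V Δ Δm) (O : Ont C R Iv V) : Prop :=
  ∀ p ∈ O, I.Sat p.1 p.2

end Interp

/-- O ⊨ (α, m) -/
def Entails {C R Iv V : Type} [DecidableEq V] (O : Ont C R Iv V) (α : Ax C R Iv)
    (m : Monomial V) : Prop :=
  ∀ (Δ Δm : Type) (I : Interp C R Iv V Δ Δm), I.IsModel O → I.Sat α m

end Prov

namespace Prov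

variable {C R Iv V : Type} [DecidableEq V]

/-- one application of a normalization rule NF1–NF3, where the introduced
    concept name `A` is fresh (does not occur in the ontology). -/
inductive NormStep : Ont C R Iv V → Ont C R Iv V → Prop
  | nf1 (O : Ont C R Iv V) (c d e : Concept C R) (v : Monomial V) (A : C) :
      (Ax.gci (Concept.conj c d) e, v) ∈ O → ¬ d.IsBasic → A ∉ Ont.cnames O →
      NormStep O ((O \ {(Ax.gci (Concept.conj c d) e, v)}) ∪
        {(Ax.gci d (Concept.atom A), (∅ : Monomial V)),
         (Ax.gci (Concept.conj c (Concept.atom A)) e, v)})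
  | nf2 (O : Ont C R Iv V) (r : R) (c d : Concept C R) (v : Monomial V) (A : C) :
      (Ax.gci (Concept.ex r c) d, v) ∈ O → ¬ c.IsBasic → A ∉ Ont.cnames O →
      NormStep O ((O \ {(Ax.gci (Concept.ex r c) d, v)}) ∪
        {(Ax.gci c (Concept.atom A), (∅ : Monomial V)),
         (Ax.gci (Concept.ex r (Concept.atom A)) d, v)})
  | nf3 (O : Ont C R Iv V) (c : Concept C R) (r : R) (v : Monomial V) (A : C) :
      (Ax.gci c (Concept.ex r Concept.top), v) ∈ O → ¬ c.IsBasic → A ∉ Ont.cnames O →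
      NormStep O ((O \ {(Ax.gci c (Concept.ex r Concept.top), v)}) ∪
        {(Ax.gci c (Concept.atom A), (∅ : Monomial V)),
         (Ax.gci (Concept.atom A) (Concept.ex r Concept.top), v)})

/-- The interpretation obtained from `I` by reinterpreting the concept name `A` as `S`. -/
noncomputable def Interp.updateCon {Δ Δm : Type} (I : Interp C R Iv V Δ Δm) (A : C)
    (S : Set (Δ × Δm)) : Interp C R Iv V Δ Δm :=
  open Classical in { I with conI := Function.update I.conI A S }

namespace Interp
variable {Δ Δm : Type} (I : Interp C R Iv V Δ Δm)

theorem updateCon_cInt_atom (A : C) (S : Set (Δ × Δm)) :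
    (I.updateCon A S).cInt (Concept.atom A) = S := by
  simp [cInt, updateCon]

theorem updateCon_cInt (A : C) (S : Set (Δ × Δm)) (c : Concept C R) (h : A ∉ c.cnames) :
    (I.updateCon A S).cInt c = I.cInt c := by
  induction c with
  | top => rfl
  | atom B =>
    have hB : B ≠ A := fun e => h (by simp [Concept.cnames, e])
    classical exact Function.update_of_ne hB S I.conI
  | conj c d ihc ihd =>
    simp only [Concept.cnames, Set.mem_union, not_or] at h
    simp only [cInt, ihc h.1, ihd h.2]
    rfl
  | ex r c ih =>
    simp only [cInt, ih h]
    rfl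

theorem updateCon_sat (A : C) (S : Set (Δ × Δm)) (α : Ax C R Iv) (m : Monomial V)
    (h : A ∉ α.cnames) : (I.updateCon A S).Sat α m ↔ I.Sat α m := by
  cases α with
  | gci c d =>
    simp only [Ax.cnames, Set.mem_union, not_or] at h
    simp only [Sat, updateCon_cInt I A S c h.1, updateCon_cInt I A S d h.2]
    rfl
  | ri r s => rfl
  | rr r B =>
    have hB : (I.updateCon A S).conI B = I.conI B :=
      updateCon_cInt I A S (Concept.atom B) h
    simp only [Sat, hB]
    rfl
  | ca c a =>
    simp only [Sat, updateCon_cInt I A S c h]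
    rfl
  | ra r a b => rfl

theorem sat_gci_congr {c c' : Concept C R} (h : I.cInt c = I.cInt c') (d : Concept C R)
    (m : Monomial V) :
    I.Sat (Ax.gci c d) m ↔ I.Sat (Ax.gci c' d) m := by
  simp only [Sat, h]

theorem cInt_conj_congr (c : Concept C R) {d d' : Concept C R} (h : I.cInt d = I.cInt d') :
    I.cInt (Concept.conj c d) = I.cInt (Concept.conj c d') := by
  simp only [cInt, h]

theorem cInt_ex_congr (r : R) {c c' : Concept C R} (h : I.cInt c = I.cInt c') :
    I.cInt (Concept.ex r c) = I.cInt (Concept.ex r c') := by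
  simp only [cInt, h]

theorem sat_gci_one_of_eq {c d : Concept C R} (h : I.cInt c = I.cInt d) :
    I.Sat (Ax.gci c d) ∅ := by
  intro x n hx
  rw [Finset.empty_union, ← h]
  exact hx

end Interp

/-- Replacing an axiom `p` by a definition `d ⊑ A` of a name `A` and a further axiom `q`, where
`q` together with the definition implies `p`, and `p` implies `q` once `A` means `d`. -/
structure IsUnfolding (p : AnnAx C R Iv V) (d : Concept C R) (A : C) (q : AnnAx C R Iv V) :
    Prop where
  cnames_left : p.1.cnames ⊆ d.cnames ∪ q.1.cnames
  cnames_right : d.cnames ⊆ p.1.cnames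
  sound : ∀ (Δ Δm : Type) (I : Interp C R Iv V Δ Δm),
    I.Sat (Ax.gci d (Concept.atom A)) ∅ → I.Sat q.1 q.2 → I.Sat p.1 p.2
  complete : ∀ (Δ Δm : Type) (I : Interp C R Iv V Δ Δm),
    I.cInt d = I.cInt (Concept.atom A) → I.Sat p.1 p.2 → I.Sat q.1 q.2

theorem isUnfolding_conj (c d e : Concept C R) (v : Monomial V) (A : C) :
    IsUnfolding (Iv := Iv) (Ax.gci (Concept.conj c d) e, v) d A
      (Ax.gci (Concept.conj c (Concept.atom A)) e, v) where
  cnames_left := by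
    intro B
    simp only [Ax.cnames, Concept.cnames, Set.mem_union]
    tauto
  cnames_right := fun B hB => Or.inl (Or.inr hB)
  sound := by
    rintro Δ Δm I hd hq x n ⟨y, k, l, hk, hl, hy⟩
    obtain ⟨rfl, hn⟩ := Prod.mk.inj hy
    have hA := hd x l hl
    rw [Finset.empty_union] at hA
    exact hq x n ⟨x, k, l, hk, hA, hy⟩
  complete := fun _ _ I h hp => (I.sat_gci_congr (I.cInt_conj_congr c h) e v).1 hp

theorem isUnfolding_ex (r : R) (c d : Concept C R) (v : Monomial V) (A : C) :
    IsUnfolding (Iv := Iv) (Ax.gci (Concept.ex r c) d, v) c A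
      (Ax.gci (Concept.ex r (Concept.atom A)) d, v) where
  cnames_left := by
    intro B
    simp only [Ax.cnames, Concept.cnames, Set.mem_union]
    tauto
  cnames_right := fun B hB => Or.inl hB
  sound := by
    rintro Δ Δm I hd hq x n ⟨y, z, k, l, hk, hl, hy⟩
    have hA := hd z l hl
    rw [Finset.empty_union] at hA
    exact hq x n ⟨y, z, k, l, hk, hA, hy⟩
  complete := fun _ _ I h hp => (I.sat_gci_congr (I.cInt_ex_congr r h) d v).1 hp

theorem isUnfolding_lhs (c d : Concept C R) (v : Monomial V) (A : C) :
    IsUnfolding (Iv := Iv) (Ax.gci c d, v) c A (Ax.gci (Concept.atom A) d, v) where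
  cnames_left := by
    intro B
    simp only [Ax.cnames, Set.mem_union]
    tauto
  cnames_right := fun B hB => Or.inl hB
  sound := by
    intro Δ Δm I hd hq x n hx
    have hA := hd x n hx
    rw [Finset.empty_union] at hA
    exact hq x n hA
  complete := fun _ _ I h hp => (I.sat_gci_congr h d v).1 hp

theorem NormStep.exists_isUnfolding {O O' : Ont C R Iv V} (h : NormStep O O') :
    ∃ p ∈ O, ∃ d A q, A ∉ Ont.cnames O ∧ IsUnfolding p d A q ∧
      O' = (O \ {p}) ∪ {(Ax.gci d (Concept.atom A), (∅ : Monomial V)), q} := by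
  cases h with
  | nf1 c d e v A hp _ hA => exact ⟨_, hp, d, A, _, hA, isUnfolding_conj c d e v A, rfl⟩
  | nf2 r c d v A hp _ hA => exact ⟨_, hp, c, A, _, hA, isUnfolding_ex r c d v A, rfl⟩
  | nf3 c r v A hp _ hA => exact ⟨_, hp, c, A, _, hA, isUnfolding_lhs c _ v A, rfl⟩

theorem NormStep.cnames_subset {O O' : Ont C R Iv V} (h : NormStep O O') :
    Ont.cnames O ⊆ Ont.cnames O' := by
  obtain ⟨p, _, d, A, q, _, hu, rfl⟩ := h.exists_isUnfolding
  rintro B ⟨s, hs, hB⟩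
  by_cases hsp : s = p
  · subst hsp
    rcases hu.cnames_left hB with hB | hB
    · exact ⟨_, Or.inr (Or.inl rfl), Or.inl hB⟩
    · exact ⟨q, Or.inr (Or.inr rfl), hB⟩
  · exact ⟨s, Or.inl ⟨hs, hsp⟩, hB⟩

theorem NormStep.isModel_of_isModel {O O' : Ont C R Iv V} (h : NormStep O O') {Δ Δm : Type}
    {I : Interp C R Iv V Δ Δm} (hI : I.IsModel O') : I.IsModel O := by
  obtain ⟨p, _, d, A, q, _, hu, rfl⟩ := h.exists_isUnfolding
  intro s hs
  by_cases hsp : s = p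
  · subst hsp
    exact hu.sound Δ Δm I (hI _ (Or.inr (Or.inl rfl))) (hI _ (Or.inr (Or.inr rfl)))
  · exact hI s (Or.inl ⟨hs, hsp⟩)

theorem NormStep.exists_updateCon_isModel {O O' : Ont C R Iv V} (h : NormStep O O')
    {Δ Δm : Type} {I : Interp C R Iv V Δ Δm} (hI : I.IsModel O) :
    ∃ A S, A ∉ Ont.cnames O ∧ (I.updateCon A S).IsModel O' := by
  obtain ⟨p, hp, d, A, q, hA, hu, rfl⟩ := h.exists_isUnfolding
  have hold : ∀ s ∈ O, (I.updateCon A (I.cInt d)).Sat s.1 s.2 := fun s hs =>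
    (I.updateCon_sat A _ s.1 s.2 fun hB => hA ⟨s, hs, hB⟩).2 (hI s hs)
  have hd : (I.updateCon A (I.cInt d)).cInt d =
      (I.updateCon A (I.cInt d)).cInt (Concept.atom A) := by
    rw [I.updateCon_cInt_atom, I.updateCon_cInt A _ d fun hB => hA ⟨p, hp, hu.cnames_right hB⟩]
  refine ⟨A, I.cInt d, hA, ?_⟩
  rintro s (⟨hs, -⟩ | rfl | rfl)
  · exact hold s hs
  · exact Interp.sat_gci_one_of_eq _ hd
  · exact hu.complete Δ Δm _ hd (hold p hp)

theorem NormStep.entails {O O' : Ont C R Iv V} (h : NormStep O O') {α : Ax C R Iv}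
    {m : Monomial V} (hO : Entails O α m) : Entails O' α m :=
  fun Δ Δm I hI => hO Δ Δm I (h.isModel_of_isModel hI)

theorem NormStep.entails_of_entails {O O' : Ont C R Iv V} (h : NormStep O O') {α : Ax C R Iv}
    {m : Monomial V} (hO' : Entails O' α m) (hα : α.cnames ⊆ Ont.cnames O) :
    Entails O α m := by
  intro Δ Δm I hI
  obtain ⟨A, S, hA, hJ⟩ := h.exists_updateCon_isModel hI
  exact (I.updateCon_sat A S α m fun hB => hA (hα hB)).1 (hO' Δ Δm _ hJ)

/-- Let O be an annotated ELH^r ontology, α an ELH^r axiom and m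
    a monomial, and O' obtained from O by exhaustively applying NF1–NF3.  Then
    (i) if O ⊨ (α,m) then O' ⊨ (α,m), and (ii) if O' ⊨ (α,m) and every concept
    name occurring in α occurs in O, then O ⊨ (α,m). -/
theorem stmt0 (O O' : Ont C R Iv V) (hO : IsOntology O)
    (hsteps : Relation.ReflTransGen NormStep O O')
    (hexh : ∀ O'', ¬ NormStep O' O'')
    (α : Ax C R Iv) (hα : α.IsELHr) (m : Monomial V) :
    (Entails O α m → Entails O' α m) ∧
    ((Entails O' α m ∧ α.cnames ⊆ Ont.cnames O) → Entails O α m) := by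
  clear hO
  induction hsteps using Relation.ReflTransGen.head_induction_on with
  | refl => exact ⟨id, And.left⟩
  | head h _ ih =>
    exact ⟨fun hE => ih.1 (h.entails hE), fun ⟨hE, hα⟩ =>
      h.entails_of_entails (ih.2 ⟨hE, hα.trans h.cnames_subset⟩) hα⟩

end Prov
end

section
/- Let O be an annotated ELH^r ontology, C, C₁, C₂, D₁, D₂, D, D' ELH^r concepts, S, R ∈ N_R, and m, m₁, m₂ monomials. Then: (1) if O ⊨ (C ⊑ C₁ ⊓ C₂, m), O ⊨ (C₁ ⊑ D₁, m₁) and O ⊨ (C₂ ⊑ D₂, m₂), then O ⊨ (C ⊑ D₁ ⊓ D₂, m×m₁×m₂); (2) if O ⊨ (C ⊑ ∃S.D', m) and O ⊨ (D' ⊑ D, m₁), then O ⊨ (C ⊑ ∃S.D, m×m₁); (3) if O ⊨ (C ⊑ ∃R.D, m) and O ⊨ (R ⊑ S, m₁), then O ⊨ (C ⊑ ∃S.D, m×m₁). -/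
namespace Prov

variable {C R Iv V : Type} [DecidableEq V]

namespace Interp

variable {Δ Δm : Type} (I : Interp C R Iv V Δ Δm)

theorem mem_cInt_conj {c d : Concept C R} {x : Δ} {k : Monomial V} :
    (x, I.monI k) ∈ I.cInt (Concept.conj c d) ↔
      ∃ p q, (x, I.monI p) ∈ I.cInt c ∧ (x, I.monI q) ∈ I.cInt d ∧ k = p ∪ q := by
  simp [cInt, I.monI_inj.eq_iff]

theorem mem_cInt_ex {r : R} {c : Concept C R} {x : Δ} {k : Monomial V} :
    (x, I.monI k) ∈ I.cInt (Concept.ex r c) ↔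
      ∃ e p q, (x, e, I.monI p) ∈ I.rolI r ∧ (e, I.monI q) ∈ I.cInt c ∧ k = p ∪ q := by
  simp [cInt, I.monI_inj.eq_iff]

variable {I} {c c₁ c₂ d₁ d₂ d d' : Concept C R} {r s : R} {m m₁ m₂ : Monomial V}

theorem Sat.gci_conj (h : I.Sat (Ax.gci c (Concept.conj c₁ c₂)) m)
    (h₁ : I.Sat (Ax.gci c₁ d₁) m₁) (h₂ : I.Sat (Ax.gci c₂ d₂) m₂) :
    I.Sat (Ax.gci c (Concept.conj d₁ d₂)) (m ∪ m₁ ∪ m₂) := by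
  intro x n hx
  obtain ⟨p, q, hp, hq, hpq⟩ := I.mem_cInt_conj.1 (h x n hx)
  refine I.mem_cInt_conj.2 ⟨_, _, h₁ x p hp, h₂ x q hq, ?_⟩
  calc m ∪ m₁ ∪ m₂ ∪ n = (m₁ ∪ m₂) ∪ (m ∪ n) := by ac_rfl
    _ = (m₁ ∪ p) ∪ (m₂ ∪ q) := by rw [hpq]; ac_rfl

theorem Sat.gci_ex_concept (h : I.Sat (Ax.gci c (Concept.ex s d')) m)
    (h₁ : I.Sat (Ax.gci d' d) m₁) : I.Sat (Ax.gci c (Concept.ex s d)) (m ∪ m₁) := by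
  intro x n hx
  obtain ⟨e, p, q, hp, hq, hpq⟩ := I.mem_cInt_ex.1 (h x n hx)
  refine I.mem_cInt_ex.2 ⟨e, _, _, hp, h₁ e q hq, ?_⟩
  calc m ∪ m₁ ∪ n = m₁ ∪ (m ∪ n) := by ac_rfl
    _ = p ∪ (m₁ ∪ q) := by rw [hpq]; ac_rfl

theorem Sat.gci_ex_role (h : I.Sat (Ax.gci c (Concept.ex r d)) m)
    (h₁ : I.Sat (Ax.ri r s) m₁) : I.Sat (Ax.gci c (Concept.ex s d)) (m ∪ m₁) := by
  intro x n hx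
  obtain ⟨e, p, q, hp, hq, hpq⟩ := I.mem_cInt_ex.1 (h x n hx)
  refine I.mem_cInt_ex.2 ⟨e, _, _, h₁ x e p hp, hq, ?_⟩
  calc m ∪ m₁ ∪ n = m₁ ∪ (m ∪ n) := by ac_rfl
    _ = (m₁ ∪ p) ∪ q := by rw [hpq]; ac_rfl

end Interp

/-- Lemma on GCIs with complex right-hand sides. -/
theorem stmt1 (O : Ont C R Iv V) (hO : IsOntology O)
    (c c₁ c₂ d₁ d₂ d d' : Concept C R) (s r : R) (m m₁ m₂ : Monomial V) :
    (Entails O (Ax.gci c (Concept.conj c₁ c₂)) m →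
      Entails O (Ax.gci c₁ d₁) m₁ → Entails O (Ax.gci c₂ d₂) m₂ →
      Entails O (Ax.gci c (Concept.conj d₁ d₂)) (m ∪ m₁ ∪ m₂)) ∧
    (Entails O (Ax.gci c (Concept.ex s d')) m → Entails O (Ax.gci d' d) m₁ →
      Entails O (Ax.gci c (Concept.ex s d)) (m ∪ m₁)) ∧
    (Entails O (Ax.gci c (Concept.ex r d)) m → Entails O (Ax.ri r s) m₁ →
      Entails O (Ax.gci c (Concept.ex s d)) (m ∪ m₁)) := by
  refine ⟨fun h h₁ h₂ Δ Δm I hI => ?_, fun h h₁ Δ Δm I hI => ?_, fun h h₁ Δ Δm I hI => ?_⟩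
  · exact (h Δ Δm I hI).gci_conj (h₁ Δ Δm I hI) (h₂ Δ Δm I hI)
  · exact (h Δ Δm I hI).gci_ex_concept (h₁ Δ Δm I hI)
  · exact (h Δ Δm I hI).gci_ex_role (h₁ Δ Δm I hI)

end Prov
end

section
/- Let O be an annotated ELH^r ontology, S, R ∈ N_R, m a monomial, and a₀, b₀ ∈ N_I individual names not occurring in O. Then O ⊨ (S ⊑ R, m) if and only if O ∪ {(S(a₀,b₀), 1)} ⊨ (R(a₀,b₀), m). -/
namespace Prov

variable {C R Iv V : Type} [DecidableEq V]

/-- Every ontology entails the trivial role inclusion annotated with `1`. -/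
lemma entails_ri_refl (O : Ont C R Iv V) (s : R) : Entails O (Ax.ri s s) ∅ := by
  intro Δ Δm I _ x y n h
  rwa [Finset.empty_union]

/-- Entailed role inclusions compose with the role inclusions of the ontology. -/
lemma Entails.ri_trans {O : Ont C R Iv V} {s r t : R} {k v : Monomial V}
    (h : Entails O (Ax.ri s r) k) (hv : (Ax.ri r t, v) ∈ O) :
    Entails O (Ax.ri s t) (v ∪ k) := by
  intro Δ Δm I hI x y n hn
  rw [Finset.union_assoc]
  exact hI _ hv x y (k ∪ n) (h Δ Δm I hI x y n hn)

/-- The interpretation whose domain has two elements, `True` interpreting `a₀` and `b₀` and `False`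
interpreting all other individuals, in which every concept and role fact holds except that `True`
is an `r`-successor of itself exactly with the annotations `k` such that `O ⊨ (s ⊑ r, k)`. -/
def roleInterp (O : Ont C R Iv V) (s : R) (a₀ b₀ : Iv) : Interp C R Iv V Prop (Monomial V) where
  indI a := a = a₀ ∨ a = b₀
  conI _ := Set.univ
  rolI r := {p | p.1 → p.2.1 → Entails O (Ax.ri s r) p.2.2}
  monI := id
  monI_inj := Function.injective_id
  neD := ⟨True⟩
  neDm := ⟨∅⟩

lemma roleInterp_isModel {O : Ont C R Iv V} (hO : IsOntology O) (s : R) {a₀ b₀ : Iv}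
    (ha : a₀ ∉ Ont.inds O) (hb : b₀ ∉ Ont.inds O) :
    (roleInterp O s a₀ b₀).IsModel O := by
  rintro ⟨α, v⟩ hp
  have hE := (hO.2 _ hp).1
  cases α with
  | gci c d =>
    intro x n _
    rcases hE with ⟨A, rfl⟩ | ⟨r, rfl⟩
    · trivial
    · exact ⟨x, False, v ∪ n, ∅, fun _ h => h.elim, rfl, by rw [Finset.union_empty]⟩
  | ri r t => exact fun x y n h hx hy => (h hx hy).ri_trans hp
  | rr r A => exact fun _ _ _ => trivial
  | ca c a =>
    obtain ⟨A, rfl⟩ := hE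
    trivial
  | ra r a b =>
    rintro (rfl | rfl)
    · exact (ha ⟨_, hp, Or.inl rfl⟩).elim
    · exact (hb ⟨_, hp, Or.inl rfl⟩).elim

/-- O ⊨ (S ⊑ R, m) iff O ∪ {(S(a₀,b₀), 1)} ⊨ (R(a₀,b₀), m),
    for a₀, b₀ individual names not occurring in O. -/
theorem stmt4 (O : Ont C R Iv V) (hO : IsOntology O)
    (s r : R) (m : Monomial V)
    (a₀ b₀ : Iv) (ha : a₀ ∉ Ont.inds O) (hb : b₀ ∉ Ont.inds O) :
    Entails O (Ax.ri s r) m ↔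
      Entails (O ∪ {(Ax.ra s a₀ b₀, (∅ : Monomial V))}) (Ax.ra r a₀ b₀) m := by
  constructor
  · intro h Δ Δm I hI
    have hs := hI (Ax.ra s a₀ b₀, ∅) (Or.inr rfl)
    have hr := h Δ Δm I (fun p hp => hI p (Or.inl hp)) _ _ ∅ hs
    rwa [Finset.union_empty] at hr
  · intro h
    refine h _ _ (roleInterp O s a₀ b₀) ?_ (Or.inl rfl) (Or.inr rfl)
    rintro p (hp | rfl)
    · exact roleInterp_isModel hO s ha hb p hp
    · exact fun _ _ => entails_ri_refl O s

end Prov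
end

section
/- Let O be an annotated ELH^r ontology in normal form and k ≥ 0. Every annotated axiom in the k-saturation O_k either belongs to O or is of the form (α, [m]), where α is an ELH^r axiom built from concept, role and individual names occurring in O (together with ⊤) containing at most three occurrences of such names, and m is a product of at most k distinct variables occurring in O. Consequently, O_k is a finite set. -/
namespace Prov

variable {C R Iv V : Type} [DecidableEq V]

/-- One instance of a completion rule CR0–CR16: `sig` supplies the signature
    conditions ("occurs in O"), `S` supplies the premises, and the conclusion
    is the derived annotated axiom.  Letters A,…,D range over N_C ∪ {⊤}. -/
inductive CRrule (sig S : Ont C R Iv V) : Ax C R Iv → Monomial V → Prop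
  | cr0c {A : C} : A ∈ Ont.cnames sig →
      CRrule sig S (Ax.gci (Concept.atom A) (Concept.atom A)) ∅
  | cr0r {r : R} : r ∈ Ont.rnames sig → CRrule sig S (Ax.ri r r) ∅
  | cr0t : Ont.hasTop sig → CRrule sig S (Ax.gci Concept.top Concept.top) ∅
  | cr1 {r₁ r₂ r₃ : R} {m₁ m₂ : Monomial V} :
      (Ax.ri r₁ r₂, m₁) ∈ S → (Ax.ri r₂ r₃, m₂) ∈ S →
      CRrule sig S (Ax.ri r₁ r₃) (m₁ ∪ m₂)
  | cr2 {r s : R} {A : C} {m₁ m₂ : Monomial V} :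
      (Ax.ri r s, m₁) ∈ S → (Ax.rr s A, m₂) ∈ S →
      CRrule sig S (Ax.rr r A) (m₁ ∪ m₂)
  | cr3 {A : Concept C R} {r s : R} {m₁ m₂ : Monomial V} : A.IsBasic →
      (Ax.gci A (Concept.ex r Concept.top), m₁) ∈ S → (Ax.ri r s, m₂) ∈ S →
      CRrule sig S (Ax.gci A (Concept.ex s Concept.top)) (m₁ ∪ m₂)
  | cr4 {A B Cc : Concept C R} {m₁ m₂ : Monomial V} :
      A.IsBasic → B.IsBasic → Cc.IsBasic →
      (Ax.gci A B, m₁) ∈ S → (Ax.gci B Cc, m₂) ∈ S →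
      CRrule sig S (Ax.gci A Cc) (m₁ ∪ m₂)
  | cr5 {A B : Concept C R} {r : R} {m₁ m₂ : Monomial V} : A.IsBasic → B.IsBasic →
      (Ax.gci A B, m₁) ∈ S → (Ax.gci B (Concept.ex r Concept.top), m₂) ∈ S →
      CRrule sig S (Ax.gci A (Concept.ex r Concept.top)) (m₁ ∪ m₂)
  | cr6 {A B₁ B₂ Cc : Concept C R} {m₁ m₂ m₃ : Monomial V} :
      A.IsBasic → B₁.IsBasic → B₂.IsBasic → Cc.IsBasic →
      (Ax.gci A B₁, m₁) ∈ S → (Ax.gci A B₂, m₂) ∈ S →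
      (Ax.gci (Concept.conj B₁ B₂) Cc, m₃) ∈ S →
      CRrule sig S (Ax.gci A Cc) (m₁ ∪ m₂ ∪ m₃)
  | cr7 {r : R} {B₁ B₂ Cc : C} {C₁ C₂ : Concept C R} {m₁ m₂ m₃ m₄ m₅ : Monomial V} :
      C₁.IsBasic → C₂.IsBasic →
      (Ax.rr r B₁, m₁) ∈ S → (Ax.rr r B₂, m₂) ∈ S →
      (Ax.gci (Concept.atom B₁) C₁, m₃) ∈ S → (Ax.gci (Concept.atom B₂) C₂, m₄) ∈ S →
      (Ax.gci (Concept.conj C₁ C₂) (Concept.atom Cc), m₅) ∈ S →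
      CRrule sig S (Ax.rr r Cc) (m₁ ∪ m₂ ∪ m₃ ∪ m₄ ∪ m₅)
  | cr8 {A B Cc : Concept C R} {m₁ m₂ : Monomial V} :
      A.IsBasic → B.IsBasic → Cc.IsBasic →
      (Ax.gci (Concept.conj A B) Cc, m₁) ∈ S → (Ax.gci Concept.top B, m₂) ∈ S →
      CRrule sig S (Ax.gci A Cc) (m₁ ∪ m₂)
  | cr9 {A Cc D : Concept C R} {s r : R} {B : C} {m₁ m₂ m₃ m₄ m₅ : Monomial V} :
      A.IsBasic → Cc.IsBasic → D.IsBasic →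
      (Ax.gci A (Concept.ex s Concept.top), m₁) ∈ S → (Ax.rr s B, m₂) ∈ S →
      (Ax.gci (Concept.atom B) Cc, m₃) ∈ S → (Ax.ri s r, m₄) ∈ S →
      (Ax.gci (Concept.ex r Cc) D, m₅) ∈ S →
      CRrule sig S (Ax.gci A D) (m₁ ∪ m₂ ∪ m₃ ∪ m₄ ∪ m₅)
  | cr10 {A B Cc : Concept C R} {r : R} {m₁ m₂ m₃ : Monomial V} :
      A.IsBasic → B.IsBasic → Cc.IsBasic →
      (Ax.gci A (Concept.ex r Concept.top), m₁) ∈ S → (Ax.gci Concept.top B, m₂) ∈ S →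
      (Ax.gci (Concept.ex r B) Cc, m₃) ∈ S →
      CRrule sig S (Ax.gci A Cc) (m₁ ∪ m₂ ∪ m₃)
  | cr11 {a : Iv} : a ∈ Ont.inds sig → CRrule sig S (Ax.ca Concept.top a) ∅
  | cr12 {r s : R} {a b : Iv} {m₁ m₂ : Monomial V} :
      (Ax.ra r a b, m₁) ∈ S → (Ax.ri r s, m₂) ∈ S →
      CRrule sig S (Ax.ra s a b) (m₁ ∪ m₂)
  | cr13 {A B : Concept C R} {a : Iv} {m₁ m₂ : Monomial V} : A.IsBasic → B.IsBasic →
      (Ax.ca A a, m₁) ∈ S → (Ax.gci A B, m₂) ∈ S →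
      CRrule sig S (Ax.ca B a) (m₁ ∪ m₂)
  | cr14 {A₁ A₂ B : Concept C R} {a : Iv} {m₁ m₂ m₃ : Monomial V} :
      A₁.IsBasic → A₂.IsBasic → B.IsBasic →
      (Ax.ca A₁ a, m₁) ∈ S → (Ax.ca A₂ a, m₂) ∈ S →
      (Ax.gci (Concept.conj A₁ A₂) B, m₃) ∈ S →
      CRrule sig S (Ax.ca B a) (m₁ ∪ m₂ ∪ m₃)
  | cr15 {r : R} {A B : Concept C R} {a b : Iv} {m₁ m₂ m₃ : Monomial V} :
      A.IsBasic → B.IsBasic →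
      (Ax.ra r a b, m₁) ∈ S → (Ax.ca A b, m₂) ∈ S →
      (Ax.gci (Concept.ex r A) B, m₃) ∈ S →
      CRrule sig S (Ax.ca B a) (m₁ ∪ m₂ ∪ m₃)
  | cr16 {r : R} {A : C} {a b : Iv} {m₁ m₂ : Monomial V} :
      (Ax.ra r a b, m₁) ∈ S → (Ax.rr r A, m₂) ∈ S →
      CRrule sig S (Ax.ca (Concept.atom A) b) (m₁ ∪ m₂)

/-- `S` contains `O` and is closed under the completion rules restricted to
    monomials with at most k variables. -/
def SatClosed (O : Ont C R Iv V) (k : ℕ) (S : Ont C R Iv V) : Prop :=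
  O ⊆ S ∧ ∀ α m, CRrule O S α m → m.card ≤ k → (α, m) ∈ S

/-- the k-saturation O_k of O, the result of exhaustively applying the
    completion rules to O restricted to monomials with ≤ k variables
    (least such closed set). -/
def kSat (O : Ont C R Iv V) (k : ℕ) : Ont C R Iv V :=
  ⋂₀ {S | SatClosed O k S}

end Prov

namespace Prov

variable {C R Iv V : Type} [DecidableEq V]

/-- The names of an annotated axiom and the variables of its annotation all occur in `O`. -/
def InSignature (O : Ont C R Iv V) (p : AnnAx C R Iv V) : Prop :=
  p.1.cnames ⊆ Ont.cnames O ∧ p.1.rnames ⊆ Ont.rnames O ∧ p.1.inds ⊆ Ont.inds O ∧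
    (↑p.2 : Set V) ⊆ Ont.vars O

/-- The shapes of axioms that the completion rules can derive. -/
def Ax.IsDerivedShape : Ax C R Iv → Prop
  | .gci c d => c.IsBasic ∧ (d.IsBasic ∨ ∃ r, d = Concept.ex r Concept.top)
  | .ca c _ => c.IsBasic
  | _ => True

theorem inSignature_of_mem {C R Iv V : Type} {O : Ont C R Iv V} {p : AnnAx C R Iv V} (hp : p ∈ O) :
    InSignature O p :=
  ⟨fun _ h => ⟨p, hp, h⟩, fun _ h => ⟨p, hp, h⟩, fun _ h => ⟨p, hp, h⟩, fun _ h => ⟨p, hp, h⟩⟩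

theorem Concept.IsBasic.nameCount_le_one {c : Concept C R} (hc : c.IsBasic) :
    c.nameCount ≤ 1 := by
  cases c <;> simp_all [Concept.IsBasic, Concept.nameCount]

theorem Ax.IsDerivedShape.nameCount_le_three {α : Ax C R Iv} (hα : α.IsDerivedShape) :
    α.nameCount ≤ 3 := by
  cases α with
  | gci c d =>
    obtain ⟨hc, hd | ⟨r, rfl⟩⟩ := hα
    · have := hc.nameCount_le_one
      have := hd.nameCount_le_one
      simp only [Ax.nameCount]
      omega
    · have := hc.nameCount_le_one
      simp only [Ax.nameCount, Concept.nameCount]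
      omega
  | ca c a =>
    have := Concept.IsBasic.nameCount_le_one hα
    simp only [Ax.nameCount]
    omega
  | _ => simp [Ax.nameCount]

/-- The conclusion of a completion rule has a derived shape. -/
theorem CRrule.isDerivedShape {O S : Ont C R Iv V} {α : Ax C R Iv} {m : Monomial V}
    (h : CRrule O S α m) : α.IsDerivedShape := by
  cases h <;> simp_all [Ax.IsDerivedShape, Concept.IsBasic]

/-- The completion rules introduce no names or variables. -/
theorem CRrule.inSignature {O S : Ont C R Iv V} {α : Ax C R Iv} {m : Monomial V}
    (hS : ∀ p ∈ S, InSignature O p) (h : CRrule O S α m) : InSignature O (α, m) := by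
  cases h <;>
    grind [InSignature, Ax.cnames, Ax.rnames, Ax.inds, Concept.cnames, Concept.rnames]

theorem finite_setOf_isBasic {s : Set C} (hs : s.Finite) :
    {c : Concept C R | c.IsBasic ∧ c.cnames ⊆ s}.Finite := by
  refine ((hs.image Concept.atom).insert Concept.top).subset ?_
  rintro (_ | A | _ | _) ⟨hb, hA⟩ <;> simp_all [Concept.IsBasic, Concept.cnames]

/-- Over a finite signature there are finitely many axioms of a derived shape. -/
theorem finite_setOf_isDerivedShape {s : Set C} {t : Set R} {u : Set Iv}
    (hs : s.Finite) (ht : t.Finite) (hu : u.Finite) :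
    {α : Ax C R Iv | α.IsDerivedShape ∧ α.cnames ⊆ s ∧ α.rnames ⊆ t ∧ α.inds ⊆ u}.Finite := by
  have hb := finite_setOf_isBasic (R := R) hs
  have he := ht.image fun r => Concept.ex (C := C) r Concept.top
  refine (((((hb.image2 Ax.gci (hb.union he)).union (ht.image2 Ax.ri ht)).union
    (ht.image2 Ax.rr hs)).union (hb.image2 Ax.ca hu)).union
    ((ht.prod (hu.prod hu)).image fun p => Ax.ra p.1 p.2.1 p.2.2)).subset ?_
  rintro (⟨c, d⟩ | ⟨r, r'⟩ | ⟨r, A⟩ | ⟨c, a⟩ | ⟨r, a, b⟩) ⟨hα, h₁, h₂, h₃⟩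
  · obtain ⟨hc, hd | ⟨r, rfl⟩⟩ := hα <;>
      simp_all [Ax.cnames, Ax.rnames, Concept.rnames, Set.insert_subset_iff]
  all_goals
    simp_all [Ax.IsDerivedShape, Ax.cnames, Ax.rnames, Ax.inds, Set.insert_subset_iff]

theorem Concept.finite_cnames (c : Concept C R) : c.cnames.Finite := by
  induction c <;> simp_all [Concept.cnames]

theorem Concept.finite_rnames (c : Concept C R) : c.rnames.Finite := by
  induction c <;> simp_all [Concept.rnames]

theorem Ax.finite_cnames (α : Ax C R Iv) : α.cnames.Finite := by
  cases α <;> simp [Ax.cnames, Concept.finite_cnames]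

theorem Ax.finite_rnames (α : Ax C R Iv) : α.rnames.Finite := by
  cases α <;> simp [Ax.rnames, Concept.finite_rnames]

theorem Ax.finite_inds (α : Ax C R Iv) : α.inds.Finite := by
  cases α <;> simp [Ax.inds]

/-- The `k`-saturation adds to `O` only axioms of a derived
shape over the signature of `O` whose annotations have at most `k` variables. -/
theorem kSat_subset (O : Ont C R Iv V) (k : ℕ) :
    kSat O k ⊆ O ∪ {p | p.1.IsDerivedShape ∧ InSignature O p ∧ p.2.card ≤ k} := by
  refine Set.sInter_subset_of_mem ⟨Set.subset_union_left, fun α m h hm => Or.inr ?_⟩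
  exact ⟨h.isDerivedShape, h.inSignature fun p hp => hp.elim inSignature_of_mem fun h => h.2.1, hm⟩

theorem Ont.finite_setOf_exists_mem {C R Iv V X : Type} {O : Ont C R Iv V} (hO : O.Finite)
    {f : AnnAx C R Iv V → Set X} (hf : ∀ p, (f p).Finite) : {x | ∃ p ∈ O, x ∈ f p}.Finite := by
  refine (hO.biUnion fun p _ => hf p).subset ?_
  rintro x ⟨p, hp, hx⟩
  exact Set.mem_biUnion hp hx

theorem finite_kSat {O : Ont C R Iv V} (hO : O.Finite) (k : ℕ) : (kSat O k).Finite := by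
  have hc : (Ont.cnames O).Finite := Ont.finite_setOf_exists_mem hO fun p => p.1.finite_cnames
  have hr : (Ont.rnames O).Finite := Ont.finite_setOf_exists_mem hO fun p => p.1.finite_rnames
  have hi : (Ont.inds O).Finite := Ont.finite_setOf_exists_mem hO fun p => p.1.finite_inds
  have hv : (Ont.vars O).Finite := Ont.finite_setOf_exists_mem hO fun p => p.2.finite_toSet
  have hm : {m : Monomial V | (↑m : Set V) ⊆ Ont.vars O}.Finite :=
    hv.finite_subsets.preimage Finset.coe_injective.injOn
  refine (hO.union ((finite_setOf_isDerivedShape hc hr hi).prod hm)).subset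
    ((kSat_subset O k).trans (Set.union_subset_union_right _ ?_))
  rintro p ⟨hp, ⟨h₁, h₂, h₃, h₄⟩, -⟩
  exact ⟨⟨hp, h₁, h₂, h₃⟩, h₄⟩

/-- every annotated axiom of the k-saturation O_k either belongs
    to O or is of the form (α,[m]) with α built from concept, role and
    individual names occurring in O (together with ⊤), containing at most three
    occurrences of such names, and m a product of at most k distinct variables
    occurring in O.  Consequently O_k is finite. -/
theorem stmt11 (O : Ont C R Iv V) (hO : IsNFOnt O) (k : ℕ) :
    (∀ (α : Ax C R Iv) (m : Monomial V), (α, m) ∈ kSat O k →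
      ((α, m) ∈ O ∨
        (α.cnames ⊆ Ont.cnames O ∧ α.rnames ⊆ Ont.rnames O ∧
          α.inds ⊆ Ont.inds O ∧ α.nameCount ≤ 3 ∧
          (↑m : Set V) ⊆ Ont.vars O ∧ m.card ≤ k))) ∧
    (kSat O k).Finite := by
  refine ⟨fun α m h => (kSat_subset O k h).imp_right ?_, finite_kSat hO.1.1 k⟩
  rintro ⟨hα, ⟨h₁, h₂, h₃, h₄⟩, hm⟩
  exact ⟨h₁, h₂, h₃, hα.nameCount_le_three, h₄, hm⟩

end Prov
end

section
/- Let O be an annotated ELH^r ontology, C an ELH^r concept, a ∈ N_I, m a monomial, and A_C ∈ N_C a concept name not occurring in O or in C. Then O ⊨ (C(a), m) if and only if O ∪ {(C ⊑ A_C, 1)} ⊨ (A_C(a), m). -/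
namespace Prov

namespace Interp

variable {C R Iv V Δ Δm : Type}

open Classical in
/-- The interpretation `I` with the extension of the concept name `A` replaced by `S`. -/
noncomputable def updateCon_s12 (I : Interp C R Iv V Δ Δm) (A : C) (S : Set (Δ × Δm)) :
    Interp C R Iv V Δ Δm :=
  { I with conI := Function.update I.conI A S }

theorem updateCon_conI_self (I : Interp C R Iv V Δ Δm) (A : C) (S : Set (Δ × Δm)) :
    (I.updateCon_s12 A S).conI A = S := by
  simp [updateCon_s12]

theorem updateCon_conI_of_ne (I : Interp C R Iv V Δ Δm) {A B : C} (S : Set (Δ × Δm))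
    (h : B ≠ A) : (I.updateCon_s12 A S).conI B = I.conI B := by
  simp [updateCon_s12, h]

variable [DecidableEq V]

theorem cInt_updateCon (I : Interp C R Iv V Δ Δm) {A : C} (S : Set (Δ × Δm))
    (c : Concept C R) (h : A ∉ c.cnames) : (I.updateCon_s12 A S).cInt c = I.cInt c := by
  induction c with
  | top => rfl
  | atom B => exact I.updateCon_conI_of_ne S (Ne.symm h)
  | conj c d ihc ihd =>
    simp only [Concept.cnames, Set.mem_union, not_or] at h
    simp only [cInt, ihc h.1, ihd h.2]
    rfl
  | ex r c ih =>
    simp only [cInt, ih h]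
    rfl

theorem sat_updateCon_iff (I : Interp C R Iv V Δ Δm) {A : C} (S : Set (Δ × Δm))
    (α : Ax C R Iv) (m : Monomial V) (h : A ∉ α.cnames) :
    (I.updateCon_s12 A S).Sat α m ↔ I.Sat α m := by
  cases α with
  | gci c d =>
    simp only [Ax.cnames, Set.mem_union, not_or] at h
    simp only [Sat, I.cInt_updateCon S c h.1, I.cInt_updateCon S d h.2]
    rfl
  | ri r s => rfl
  | rr r B =>
    simp only [Sat, I.updateCon_conI_of_ne S (Ne.symm h)]
    rfl
  | ca c a =>
    simp only [Sat, I.cInt_updateCon S c h]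
    rfl
  | ra r a b => rfl

theorem isModel_updateCon_iff (I : Interp C R Iv V Δ Δm) {A : C} (S : Set (Δ × Δm))
    (O : Ont C R Iv V) (h : A ∉ O.cnames) :
    (I.updateCon_s12 A S).IsModel O ↔ I.IsModel O :=
  forall₂_congr fun p hp => I.sat_updateCon_iff S p.1 p.2 fun hA => h ⟨p, hp, hA⟩

end Interp

variable {C R Iv V : Type} [DecidableEq V]

/-- O ⊨ (C(a), m) iff O ∪ {(C ⊑ A_C, 1)} ⊨ (A_C(a), m),
    for A_C a concept name not occurring in O or in C.
    (Instance queries C(a) are the assertions `Ax.ca C a`.) -/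
theorem stmt12 (O : Ont C R Iv V) (hO : IsOntology O)
    (c : Concept C R) (a : Iv) (m : Monomial V)
    (Ac : C) (h1 : Ac ∉ Ont.cnames O) (h2 : Ac ∉ c.cnames) :
    Entails O (Ax.ca c a) m ↔
      Entails (O ∪ {(Ax.gci c (Concept.atom Ac), (∅ : Monomial V))})
        (Ax.ca (Concept.atom Ac) a) m := by
  constructor
  · intro h Δ Δm I hI
    have hc := h Δ Δm I fun p hp => hI p (Or.inl hp)
    have ha := hI _ (Or.inr rfl) (I.indI a) m hc
    simp only [Finset.empty_union] at ha
    exact ha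
  · intro h Δ Δm I hI
    let J := I.updateCon_s12 Ac (I.cInt c)
    have hJ : J.IsModel (O ∪ {(Ax.gci c (Concept.atom Ac), (∅ : Monomial V))}) := by
      rintro p (hp | rfl)
      · exact (I.isModel_updateCon_iff _ O h1).2 hI p hp
      · intro x n hx
        rw [I.cInt_updateCon _ c h2] at hx
        simpa [J, Interp.cInt, I.updateCon_conI_self] using hx
    have ha := h Δ Δm J hJ
    simp only [Interp.Sat, Interp.cInt, J, I.updateCon_conI_self] at ha
    exact ha


end Prov
end
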